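/- Let b be a nonnegative even integer and let k and m be positive integers with m ≥ 3. Then E_{2^m k + b} ≡ E_b - 2^m k((b+1)^2 + 10 + 2^m k (b+1)) (mod 2^{m+6}). -/

import Mathlib

/-- The Euler numbers `E n`, defined by `E 0 = 1`, `E (2n-1) = 0` for `n ≥ 1`,
and `∑_{r=0}^{n} C(2n, 2r) * E (2r) = 0` for `n ≥ 1`. -/
def eulerE : ℕ → ℤ
  | 0 => 1
  | 1 => 0
  | n + 2 =>
      if Even n then
        -∑ r ∈ (Finset.range (n / 2 + 1)).attach,
          ((n + 2).choose (2 * r.1) : ℤ) * eulerE (2 * r.1)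
      else 0
  decreasing_by
    have := r.2
    simp only [Finset.mem_range] at this
    omega

open Polynomial

theorem eulerE_odd (n : ℕ) (hn : Odd n) : eulerE n = 0 := by
  obtain _ | _ | n := n
  · simp at hn
  · simp [eulerE]
  · rw [eulerE, if_neg]
    grind

theorem sum_range_two_mul_add_one_of_odd_eq_zero {M : Type*} [AddCommMonoid M] (f : ℕ → M)
    (hf : ∀ n, Odd n → f n = 0) (k : ℕ) :
    ∑ m ∈ Finset.range (2 * k + 1), f m = ∑ r ∈ Finset.range (k + 1), f (2 * r) := by
  induction k with
  | zero => simp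
  | succ k ih =>
    rw [Finset.sum_range_succ _ (k + 1), ← ih, mul_add, Finset.sum_range_succ,
      Finset.sum_range_succ, hf (2 * k + 1) ⟨k, rfl⟩, add_zero]

theorem sum_choose_mul_eulerE (n : ℕ) (hn : Even n) (h0 : n ≠ 0) :
    ∑ m ∈ Finset.range (n + 1), (n.choose m : ℤ) * eulerE m = 0 := by
  obtain ⟨k, rfl⟩ := hn.exists_two_nsmul
  obtain _ | k := k
  · simp at h0
  rw [smul_eq_mul, sum_range_two_mul_add_one_of_odd_eq_zero _
    (fun m hm ↦ by rw [eulerE_odd m hm, mul_zero]), Finset.sum_range_succ, mul_add, mul_one,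
    Nat.choose_self, eulerE.eq_3, if_pos (even_two_mul k),
    Finset.sum_attach _ (fun r ↦ ((2 * k + 2).choose (2 * r) : ℤ) * eulerE (2 * r))]
  simp

/-- The linear functional on polynomials sending `X ^ n` to the Euler number `E n`. -/
noncomputable def eulerFunctional : ℤ[X] →ₗ[ℤ] ℤ :=
  (basisMonomials ℤ).constr ℤ eulerE

theorem eulerFunctional_X_pow (n : ℕ) : eulerFunctional (X ^ n) = eulerE n := by
  have := (basisMonomials ℤ).constr_basis ℤ eulerE n
  rw [coe_basisMonomials] at this
  rwa [← monomial_one_right_eq_X_pow]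

theorem eulerFunctional_C_mul (a : ℤ) (p : ℤ[X]) :
    eulerFunctional (C a * p) = a * eulerFunctional p := by
  rw [C_mul', map_smul, smul_eq_mul]

theorem eulerFunctional_X_add_C_pow (a : ℤ) (n : ℕ) :
    eulerFunctional ((X + C a) ^ n) =
      ∑ m ∈ Finset.range (n + 1), a ^ (n - m) * ((n.choose m : ℤ) * eulerE m) := by
  rw [add_pow, map_sum]
  refine Finset.sum_congr rfl fun m _ ↦ ?_
  have : (X ^ m * C a ^ (n - m) * (n.choose m : ℤ[X])) =
      C (a ^ (n - m) * (n.choose m : ℤ)) * X ^ m := by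
    simp
    ring
  rw [this, eulerFunctional_C_mul, eulerFunctional_X_pow, mul_assoc]

theorem eulerFunctional_shift (p : ℤ[X]) :
    eulerFunctional (p.comp (X + C 1)) + eulerFunctional (p.comp (X + C (-1))) =
      2 * p.eval 0 := by
  induction p using Polynomial.induction_on' with
  | add p q hp hq =>
    simp only [add_comp, map_add, eval_add] at *
    linarith
  | monomial n a =>
    rw [monomial_comp, monomial_comp, eulerFunctional_C_mul, eulerFunctional_C_mul,
      eulerFunctional_X_add_C_pow, eulerFunctional_X_add_C_pow, ← mul_add,
      ← Finset.sum_add_distrib, eval_monomial]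
    rcases Nat.even_or_odd n with hn | hn
    · rcases eq_or_ne n 0 with rfl | h0
      · simp [eulerE]
        ring
      have key : ∀ m ∈ Finset.range (n + 1),
          (1 : ℤ) ^ (n - m) * ((n.choose m : ℤ) * eulerE m) +
            (-1) ^ (n - m) * ((n.choose m : ℤ) * eulerE m) =
          2 * ((n.choose m : ℤ) * eulerE m) := by
        intro m hm
        rcases Nat.even_or_odd m with h | h
        · rw [(hn.tsub h).neg_one_pow, one_pow]
          ring
        · simp [eulerE_odd m h]
      rw [Finset.sum_congr rfl key, ← Finset.mul_sum, sum_choose_mul_eulerE n hn h0]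
      simp [h0]
    · rw [Finset.sum_eq_zero, zero_pow hn.pos.ne']
      · simp
      intro m hm
      rcases Nat.even_or_odd m with h | h
      · have hm' : m ≤ n := by simpa [Nat.lt_succ_iff] using hm
        rw [(Nat.Odd.sub_even hm' hn h).neg_one_pow, one_pow]
        ring
      · simp [eulerE_odd m h]

/-- The product `(X - 1) (X - 3) ⋯ (X - (2 n - 1))`. -/
noncomputable def oddFalling (n : ℕ) : ℤ[X] :=
  ∏ j ∈ Finset.range n, (X - C (2 * (j : ℤ) + 1))

theorem oddFalling_succ (n : ℕ) :
    oddFalling (n + 1) = oddFalling n * (X - C (2 * (n : ℤ) + 1)) :=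
  Finset.prod_range_succ _ _

theorem eulerFunctional_oddFalling (n : ℕ) :
    eulerFunctional (oddFalling n) = (-1) ^ n * (n.factorial : ℤ) := by
  induction n with
  | zero => simpa [oddFalling, eulerE] using eulerFunctional_X_pow 0
  | succ n ih =>
    have h := eulerFunctional_shift (∏ j ∈ Finset.range (n + 1), (X - C (2 * (j : ℤ))))
    have hm : (∏ j ∈ Finset.range (n + 1), (X - C (2 * (j : ℤ)))).comp (X + C (-1)) =
        oddFalling (n + 1) := by
      rw [prod_comp, oddFalling]
      refine Finset.prod_congr rfl fun j _ ↦ ?_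
      simp
      ring
    have hp : (∏ j ∈ Finset.range (n + 1), (X - C (2 * (j : ℤ)))).comp (X + C 1) =
        oddFalling (n + 1) + C (2 * ((n : ℤ) + 1)) * oddFalling n := by
      rw [oddFalling_succ, prod_comp, Finset.prod_range_succ', oddFalling]
      have : ∏ j ∈ Finset.range n, (X - C (2 * ((j + 1 : ℕ) : ℤ))).comp (X + C 1) =
          ∏ j ∈ Finset.range n, (X - C (2 * (j : ℤ) + 1)) := by
        refine Finset.prod_congr rfl fun j _ ↦ ?_
        simp
        ring
      rw [this]
      simp
      ring
    have h0 : (∏ j ∈ Finset.range (n + 1), (X - C (2 * (j : ℤ)))).eval 0 = 0 := by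
      rw [eval_prod]
      exact Finset.prod_eq_zero (Finset.mem_range.2 n.succ_pos) (by simp)
    rw [hm, hp, h0, map_add, eulerFunctional_C_mul, ih] at h
    rw [Nat.factorial_succ, pow_succ]
    push_cast
    linarith

/-- The integers `B s n` for which the Euler functional takes the value `(-1) ^ n * n! * B s n`
at `(X ^ 2 - 1) ^ s (X - 1) (X - 3) ⋯ (X - (2 n - 1))`. -/
def eulerMoment : ℕ → ℕ → ℤ
  | 0, _ => 1
  | s + 1, n =>
      (n + 1) * (n + 2) * eulerMoment s (n + 2) - 4 * (n + 1) ^ 2 * eulerMoment s (n + 1) +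
        4 * n * (n + 1) * eulerMoment s n

theorem eulerFunctional_pow_mul_oddFalling (s n : ℕ) :
    eulerFunctional ((X ^ 2 - 1) ^ s * oddFalling n) =
      (-1) ^ n * (n.factorial : ℤ) * eulerMoment s n := by
  induction s generalizing n with
  | zero => simp [eulerMoment, eulerFunctional_oddFalling]
  | succ s ih =>
    have h : (X ^ 2 - 1) ^ (s + 1) * oddFalling n =
        (X ^ 2 - 1) ^ s * oddFalling (n + 2) +
          C (4 * ((n : ℤ) + 1)) * ((X ^ 2 - 1) ^ s * oddFalling (n + 1)) +
          C (4 * (n : ℤ) * (n + 1)) * ((X ^ 2 - 1) ^ s * oddFalling n) := by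
      rw [oddFalling_succ, oddFalling_succ]
      simp
      ring
    rw [h, map_add, map_add, eulerFunctional_C_mul, eulerFunctional_C_mul, ih, ih, ih,
      eulerMoment, Nat.factorial_succ, Nat.factorial_succ]
    push_cast
    ring

theorem two_pow_dvd_eulerMoment (s n : ℕ) : (2 : ℤ) ^ s ∣ eulerMoment s n := by
  induction s generalizing n with
  | zero => simp
  | succ s ih =>
    obtain ⟨a, ha⟩ := ih n
    obtain ⟨b, hb⟩ := ih (n + 1)
    obtain ⟨c, hc⟩ := ih (n + 2)
    obtain ⟨p, hp⟩ := (Int.even_mul_succ_self ((n : ℤ) + 1)).two_dvd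
    refine ⟨p * c - 2 * (n + 1) ^ 2 * b + 2 * n * (n + 1) * a, ?_⟩
    rw [eulerMoment, ha, hb, hc]
    linear_combination 2 ^ s * c * hp

theorem two_pow_log_dvd_eulerMoment (s : ℕ) (hs : 6 ≤ s) :
    (2 : ℤ) ^ (7 + Nat.log 2 s) ∣ eulerMoment s 0 := by
  by_cases h : s < 10
  · have hl : (2 : ℤ) ^ (7 + Nat.log 2 s) ∣ 2 ^ (if s < 8 then 9 else 10) := by
      refine pow_dvd_pow _ ?_
      interval_cases s <;> decide
    refine hl.trans ?_
    interval_cases s <;> decide +kernel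
  · refine (pow_dvd_pow _ ?_).trans (two_pow_dvd_eulerMoment s 0)
    have h2 : Nat.log 2 s < s - 6 := by
      refine Nat.log_lt_of_lt_pow (by omega) ?_
      obtain ⟨t, rfl⟩ := Nat.exists_eq_add_of_le (not_lt.1 h)
      rw [show 10 + t - 6 = t + 4 by omega, pow_add]
      have := t.lt_two_pow_self
      omega
    omega

theorem eulerE_two_mul (n N : ℕ) (hN : n < N) :
    eulerE (2 * n) = ∑ s ∈ Finset.range N, (n.choose s : ℤ) * eulerMoment s 0 := by
  have hs (s : ℕ) : eulerFunctional ((X ^ 2 - 1) ^ s) = eulerMoment s 0 := by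
    simpa [oddFalling] using eulerFunctional_pow_mul_oddFalling s 0
  have h : (X : ℤ[X]) ^ (2 * n) =
      ∑ s ∈ Finset.range (n + 1), C (n.choose s : ℤ) * (X ^ 2 - 1) ^ s := by
    rw [pow_mul, show (X : ℤ[X]) ^ 2 = (X ^ 2 - 1) + 1 by ring, add_pow]
    refine Finset.sum_congr rfl fun s _ ↦ ?_
    simp
    ring
  rw [← eulerFunctional_X_pow, h, map_sum]
  simp only [eulerFunctional_C_mul, hs]
  refine Finset.sum_subset (by simpa using hN) fun s _ h ↦ ?_
  rw [Nat.choose_eq_zero_of_lt (by simpa using h)]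
  simp

theorem two_pow_dvd_two_pow_log_mul_choose {M h i s : ℕ} (hh : 2 ^ M ∣ h) (hi : i ≠ 0)
    (his : i ≤ s) : 2 ^ M ∣ 2 ^ Nat.log 2 s * h.choose i := by
  obtain ⟨a, o, ho, rfl⟩ := Nat.exists_eq_two_pow_mul_odd hi
  have ha : a ≤ Nat.log 2 s := by
    refine Nat.le_log_of_pow_le one_lt_two (le_trans ?_ his)
    exact Nat.le_mul_of_pos_right _ ho.pos
  refine Dvd.dvd.trans ?_ (mul_dvd_mul_right (pow_dvd_pow 2 ha) _)
  refine ((Nat.coprime_two_left.2 ho).pow_left M).dvd_of_dvd_mul_left ?_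
  rcases h with _ | h
  · rw [Nat.choose_eq_zero_of_lt (Nat.pos_of_ne_zero hi)]
    simp
  obtain ⟨j, hj⟩ := Nat.exists_eq_succ_of_ne_zero hi
  have := Nat.add_one_mul_choose_eq h j
  rw [← mul_assoc, mul_comm o, mul_comm, hj, Nat.succ_eq_add_one, ← this]
  exact hh.mul_right _

theorem two_pow_dvd_two_pow_log_mul_choose_sub {M h s : ℕ} (n : ℕ) (hh : 2 ^ M ∣ h) :
    (2 : ℤ) ^ M ∣ 2 ^ Nat.log 2 s * (((n + h).choose s : ℤ) - n.choose s) := by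
  rw [add_comm n, Nat.add_choose_eq, Finset.Nat.sum_antidiagonal_eq_sum_range_succ
    (fun i j ↦ h.choose i * n.choose j), Finset.sum_range_succ']
  rw [Nat.choose_zero_right, tsub_zero, one_mul, Nat.cast_add, add_sub_cancel_right,
    Nat.cast_sum, Finset.mul_sum]
  refine Finset.dvd_sum fun i hi ↦ ?_
  have := two_pow_dvd_two_pow_log_mul_choose hh i.succ_ne_zero (Finset.mem_range.1 hi)
  have := this.mul_right (n.choose (s - (i + 1)))
  rw [mul_assoc] at this
  exact_mod_cast this

theorem cast_choose_two_to_five (x : ℕ) :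
    2 * (x.choose 2 : ℤ) = x * (x - 1) ∧
    6 * (x.choose 3 : ℤ) = x * (x - 1) * (x - 2) ∧
    24 * (x.choose 4 : ℤ) = x * (x - 1) * (x - 2) * (x - 3) ∧
    120 * (x.choose 5 : ℤ) = x * (x - 1) * (x - 2) * (x - 3) * (x - 4) := by
  have h (k : ℕ) : ((k.factorial * x.choose k : ℕ) : ℤ) = (descPochhammer ℤ k).eval (x : ℤ) := by
    rw [← Nat.descFactorial_eq_factorial_mul_choose, descPochhammer_eval_eq_descFactorial]
  have h2 := h 2
  have h3 := h 3
  have h4 := h 4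
  have h5 := h 5
  simp [Nat.factorial, descPochhammer_succ_right] at h2 h3 h4 h5
  exact ⟨h2, h3, h4, h5⟩

theorem sum_range_six_choose_mul_eulerMoment (x : ℕ) :
    15 * ∑ s ∈ Finset.range 6, (x.choose s : ℤ) * eulerMoment s 0 =
      15 - 30 * x + 60 * (x * (x - 1)) - 200 * (x * (x - 1) * (x - 2)) +
        1040 * (x * (x - 1) * (x - 2) * (x - 3)) -
        7264 * (x * (x - 1) * (x - 2) * (x - 3) * (x - 4)) := by
  have e0 : eulerMoment 0 0 = 1 := rfl
  have e1 : eulerMoment 1 0 = -2 := by decide +kernel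
  have e2 : eulerMoment 2 0 = 8 := by decide +kernel
  have e3 : eulerMoment 3 0 = -80 := by decide +kernel
  have e4 : eulerMoment 4 0 = 1664 := by decide +kernel
  have e5 : eulerMoment 5 0 = -58112 := by decide +kernel
  obtain ⟨h2, h3, h4, h5⟩ := cast_choose_two_to_five x
  simp only [Finset.sum_range_succ, Finset.sum_range_zero, e0, e1, e2, e3, e4, e5,
    Nat.choose_zero_right, Nat.choose_one_right]
  push_cast
  linear_combination 60 * h2 - 200 * h3 + 1040 * h4 - 7264 * h5

theorem two_pow_dvd_eulerE_two_mul_add_sub (M n h : ℕ) (hM : 2 ≤ M) (hh : 2 ^ M ∣ h) :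
    (2 : ℤ) ^ (M + 7) ∣ eulerE (2 * (n + h)) - eulerE (2 * n) +
      2 * h * ((2 * n + 1) ^ 2 + 10 + 2 * h * (2 * n + 1)) := by
  rw [eulerE_two_mul (n + h) (6 + (n + h)) (by omega),
    eulerE_two_mul n (6 + (n + h)) (by omega), Finset.sum_range_add _ 6 (n + h),
    Finset.sum_range_add _ 6 (n + h)]
  have tail : (2 : ℤ) ^ (M + 7) ∣
      ∑ i ∈ Finset.range (n + h), ((n + h).choose (6 + i) : ℤ) * eulerMoment (6 + i) 0 -
      ∑ i ∈ Finset.range (n + h), (n.choose (6 + i) : ℤ) * eulerMoment (6 + i) 0 := by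
    rw [← Finset.sum_sub_distrib]
    refine Finset.dvd_sum fun i _ ↦ ?_
    obtain ⟨c, hc⟩ := two_pow_log_dvd_eulerMoment (6 + i) (by omega)
    obtain ⟨d, hd⟩ := two_pow_dvd_two_pow_log_mul_choose_sub (s := 6 + i) n hh
    refine ⟨c * d, ?_⟩
    rw [hc, pow_add, pow_add]
    linear_combination 2 ^ 7 * c * hd
  have head : (2 : ℤ) ^ (M + 7) ∣
      ∑ s ∈ Finset.range 6, ((n + h).choose s : ℤ) * eulerMoment s 0 -
      ∑ s ∈ Finset.range 6, (n.choose s : ℤ) * eulerMoment s 0 +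
      2 * h * ((2 * n + 1) ^ 2 + 10 + 2 * h * (2 * n + 1)) := by
    have hc : IsCoprime ((2 : ℤ) ^ (M + 7)) 15 :=
      IsCoprime.pow_left ⟨-7, 1, by norm_num⟩
    refine hc.dvd_of_dvd_mul_left ?_
    rw [mul_add, mul_sub, sum_range_six_choose_mul_eulerMoment,
      sum_range_six_choose_mul_eulerMoment]
    obtain ⟨g, hg⟩ := (pow_dvd_pow 2 hM).trans hh
    obtain ⟨q, hq⟩ := hh
    obtain ⟨p, hp⟩ := (Int.even_mul_succ_self (n : ℤ)).two_dvd
    have hg' : (h : ℤ) = 4 * g := by exact_mod_cast hg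
    have hq' : (h : ℤ) = 2 ^ M * q := by exact_mod_cast hq
    set w : ℤ := p ^ 2 + (-1412 + 11730 * g - 32585 * g ^ 2 + 36840 * g ^ 3 - 14528 * g ^ 4 +
      5865 * n - 24435 * n * g + 36840 * n * g ^ 2 - 18160 * n * g ^ 3 - 6109 * n ^ 2 +
      13815 * n ^ 2 * g - 9080 * n ^ 2 * g ^ 2 + 2302 * n ^ 3 - 2270 * n ^ 3 * g -
      284 * n ^ 4) with hw
    refine ⟨q * w, ?_⟩
    have hn : 32 * (n : ℤ) ^ 2 * (n + 1) ^ 2 = 128 * p ^ 2 := by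
      linear_combination 32 * (n * (n + 1) + 2 * p : ℤ) * hp
    have hr : (2 : ℤ) ^ (M + 7) * (q * w) = h * (128 * w) := by
      rw [hq', pow_add]
      ring
    rw [hr, hw]
    push_cast
    rw [hg']
    linear_combination 4 * (g : ℤ) * hn
  refine (dvd_add head tail).trans (dvd_of_eq ?_)
  ring

theorem stern_ext_mod_two_pow_add_six (b k m : ℕ) (hb : Even b) (hk : 0 < k) (hm : 3 ≤ m) :
    eulerE (2 ^ m * k + b) ≡
      eulerE b - 2 ^ m * k * (((b : ℤ) + 1) ^ 2 + 10 + 2 ^ m * k * ((b : ℤ) + 1))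
      [ZMOD 2 ^ (m + 6)] := by
  obtain ⟨n, rfl⟩ := hb.two_dvd
  obtain ⟨M, rfl⟩ := Nat.exists_eq_add_of_le' (show 1 ≤ m by omega)
  have h := two_pow_dvd_eulerE_two_mul_add_sub M n (2 ^ M * k) (by omega) (Dvd.intro _ rfl)
  refine (Int.modEq_iff_dvd.2 ?_).symm
  rw [show 2 ^ (M + 1) * k + 2 * n = 2 * (n + 2 ^ M * k) by ring]
  convert h using 1
  push_cast
  ring
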